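/- There is a constant c > 0 such that for all n, k ∈ ℕ with k ≥ (log₂ n)^12, there exists a function IExt : {0,1}^n × {0,1}^{2n} → {0,1}^m with m = ⌊0.9k⌋ such that: for every (n,k)-source X and every (k,k) block source Y = (Y₁, Y₂) with each block on {0,1}^n that is independent of X, one has |(IExt(X,Y), Y) − (U_m, Y)| ≤ ε and |(IExt(X,Y), X) − (U_m, X)| ≤ ε, where ε = 2^{−k^c}. -/

import Mathlib

open Finset

abbrev BitStr (n : ℕ) := Fin n → Bool

/-- `p` is a probability distribution on the finite type `α`. -/
def IsProb {α : Type*} [Fintype α] (p : α → ℝ) : Prop :=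
  (∀ a, 0 ≤ p a) ∧ ∑ a, p a = 1

/-- Statistical distance: `max_{T ⊆ α} |p(T) − q(T)|`. -/
noncomputable def statDist {α : Type*} [Fintype α] (p q : α → ℝ) : ℝ :=
  ⨆ T : Finset α, |∑ a ∈ T, p a - ∑ a ∈ T, q a|

/-- `H_∞(p) ≥ k`, i.e. every point has probability at most `2^(-k)`. -/
def IsKSource {α : Type*} [Fintype α] (p : α → ℝ) (k : ℝ) : Prop :=
  ∀ a, p a ≤ (2 : ℝ) ^ (-k)

/-- The uniform distribution on a finite type. -/
noncomputable def unif (α : Type*) [Fintype α] : α → ℝ := fun _ => (Fintype.card α : ℝ)⁻¹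


/-- `Y = (Y₁, Y₂)` is a `(k₁, k₂)` block source: `H_∞(Y₁) ≥ k₁` and, conditioned on any
fixing of `Y₁` in its support, `H_∞(Y₂ | Y₁ = y₁) ≥ k₂`. -/
def IsBlockSource2 {β₁ β₂ : Type*} [Fintype β₁] [Fintype β₂]
    (p : β₁ × β₂ → ℝ) (k₁ k₂ : ℝ) : Prop :=
  (∀ y₁, (∑ y₂, p (y₁, y₂)) ≤ (2 : ℝ) ^ (-k₁)) ∧
  (∀ y₁, (∑ y₂, p (y₁, y₂)) ≠ 0 →
      ∀ y₂, p (y₁, y₂) ≤ (2 : ℝ) ^ (-k₂) * ∑ y₂', p (y₁, y₂'))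


/-- Centered test function. -/
noncomputable def hTest {B Z : Type*} [Fintype Z] [DecidableEq B] [DecidableEq Z]
    (T : Finset (B × Z)) (b : B) (w : Z) : ℝ :=
  ∑ z : Z, if (b, z) ∈ T then ((if w = z then (1 : ℝ) else 0) - (Fintype.card Z : ℝ)⁻¹) else 0

section helpers
variable {B Z : Type*} [Fintype Z] [DecidableEq B] [DecidableEq Z]

lemma hTest_sum [Nonempty Z] (T : Finset (B × Z)) (b : B) : ∑ w : Z, hTest T b w = 0 := by
  unfold hTest
  rw [Finset.sum_comm]
  apply Finset.sum_eq_zero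
  intro z _
  split_ifs
  · rw [Finset.sum_sub_distrib]
    simp
  · simp

lemma hTest_abs [Nonempty Z] (T : Finset (B × Z)) (b : B) (w : Z) : |hTest T b w| ≤ 1 := by
  have hM : (0 : ℝ) < Fintype.card Z := by exact_mod_cast Fintype.card_pos
  have e : hTest T b w = (if (b, w) ∈ T then (1 : ℝ) else 0)
      - (#{z | (b, z) ∈ T} : ℝ) * (Fintype.card Z : ℝ)⁻¹ := by
    unfold hTest
    have : ∀ z : Z, (if (b, z) ∈ T then ((if w = z then (1 : ℝ) else 0) - (Fintype.card Z : ℝ)⁻¹) else 0)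
        = (if w = z then (if (b, z) ∈ T then (1 : ℝ) else 0) else 0)
          - (if (b, z) ∈ T then (Fintype.card Z : ℝ)⁻¹ else 0) := by
      intro z; split_ifs <;> simp
    simp_rw [this]
    rw [Finset.sum_sub_distrib, Finset.sum_ite_eq, ← Finset.sum_filter (fun z => (b, z) ∈ T)]
    simp
  have h1 : (#{z | (b, z) ∈ T} : ℝ) ≤ Fintype.card Z := by
    exact_mod_cast Finset.card_le_univ _
  have h2 : (#{z | (b, z) ∈ T} : ℝ) * (Fintype.card Z : ℝ)⁻¹ ≤ 1 := by
    rw [← div_eq_mul_inv]; exact (div_le_one hM).2 h1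
  have h3 : 0 ≤ (#{z | (b, z) ∈ T} : ℝ) * (Fintype.card Z : ℝ)⁻¹ := by positivity
  rw [e, abs_le]
  split_ifs <;> constructor <;> linarith

lemma hTest_congr (T : Finset (B × Z)) (S : Finset B) (b : B) (hb : b ∈ S) (w : Z) :
    hTest (T ∩ S ×ˢ univ) b w = hTest T b w := by
  unfold hTest
  simp [hb]

end helpers

lemma exp_quad (t : ℝ) (ht : |t| ≤ 1) : Real.exp t ≤ 1 + t + t ^ 2 := by
  have := Real.abs_exp_sub_one_sub_id_le ht
  have := (abs_le.1 this).2
  linarith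

/-- Chernoff counting bound. -/
lemma chernoff {I Z : Type*} [Fintype I] [Fintype Z] [DecidableEq I] [Nonempty Z]
    (S : Finset I) (u : I → Z → ℝ) (h0 : ∀ i, ∑ z, u i z = 0) (h1 : ∀ i z, |u i z| ≤ 1)
    (ε : ℝ) (he : 0 ≤ ε) (he1 : ε ≤ 1) :
    (#{f : I → Z | ε * #S < ∑ i ∈ S, u i (f i)} : ℝ)
      ≤ (Fintype.card (I → Z) : ℝ) * Real.exp (-(ε ^ 2 * #S / 4)) := by
  set M : ℝ := (Fintype.card Z : ℝ) with hMdef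
  have hM : 0 < M := by rw [hMdef]; exact_mod_cast Fintype.card_pos
  set l : ℝ := ε / 2 with hl
  have key : ∑ f : I → Z, Real.exp (l * ∑ i ∈ S, u i (f i))
      ≤ (Fintype.card (I → Z) : ℝ) * Real.exp (l ^ 2 * #S) := by
    have e1 : ∀ f : I → Z, Real.exp (l * ∑ i ∈ S, u i (f i))
        = ∏ i, (if i ∈ S then Real.exp (l * u i (f i)) else 1) := by
      intro f
      rw [Finset.mul_sum, Real.exp_sum, Finset.prod_ite_mem, Finset.univ_inter]
    simp_rw [e1]
    have e2 : ∑ f : I → Z, ∏ i, (if i ∈ S then Real.exp (l * u i (f i)) else 1)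
        = ∏ i, ∑ z : Z, (if i ∈ S then Real.exp (l * u i z) else 1) := by
      rw [Finset.prod_univ_sum, Fintype.piFinset_univ]
    rw [e2]
    have e3 : ∀ i, ∑ z : Z, (if i ∈ S then Real.exp (l * u i z) else 1)
        ≤ M * (if i ∈ S then Real.exp (l ^ 2) else 1) := by
      intro i
      split_ifs
      · calc ∑ z, Real.exp (l * u i z) ≤ ∑ z, (1 + l * u i z + l ^ 2) := by
              apply Finset.sum_le_sum
              intro z _
              have a1 : |l * u i z| ≤ 1 := by
                rw [abs_mul, abs_of_nonneg (by positivity : 0 ≤ l)]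
                have := h1 i z
                have := abs_nonneg (u i z)
                nlinarith
              have a2 := exp_quad _ a1
              have a3 : (l * u i z) ^ 2 ≤ l ^ 2 := by
                have := (sq_le_one_iff_abs_le_one (u i z)).2 (h1 i z)
                rw [mul_pow]
                nlinarith [sq_nonneg l]
              linarith
          _ = M * (1 + l ^ 2) := by
              rw [Finset.sum_add_distrib, Finset.sum_add_distrib, ← Finset.mul_sum, h0]
              simp [hMdef]; ring
          _ ≤ M * Real.exp (l ^ 2) := by
              have := Real.add_one_le_exp (l ^ 2)
              gcongr
              linarith
      · simp [hMdef]
    calc _ ≤ ∏ i, (M * (if i ∈ S then Real.exp (l ^ 2) else 1)) := by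
          apply Finset.prod_le_prod
          · intro i _
            apply Finset.sum_nonneg
            intro z _
            split_ifs <;> positivity
          · intro i _; exact e3 i
      _ = _ := by
          rw [Finset.prod_mul_distrib, Finset.prod_ite_mem, Finset.univ_inter]
          simp only [Finset.prod_const, Finset.card_univ, Fintype.card_fun]
          rw [← Real.exp_nat_mul, mul_comm (l ^ 2)]
          push_cast
          rfl
  have mk : (#{f : I → Z | ε * #S < ∑ i ∈ S, u i (f i)} : ℝ) * Real.exp (l * (ε * #S))
      ≤ ∑ f : I → Z, Real.exp (l * ∑ i ∈ S, u i (f i)) := by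
    calc _ = ∑ f ∈ ({f : I → Z | ε * #S < ∑ i ∈ S, u i (f i)} : Finset _), Real.exp (l * (ε * #S)) := by
          rw [Finset.sum_const, nsmul_eq_mul]
      _ ≤ ∑ f ∈ ({f : I → Z | ε * #S < ∑ i ∈ S, u i (f i)} : Finset _),
            Real.exp (l * ∑ i ∈ S, u i (f i)) := by
          apply Finset.sum_le_sum
          intro f hf
          have := (Finset.mem_filter.1 hf).2
          apply Real.exp_le_exp.2
          apply mul_le_mul_of_nonneg_left this.le
          positivity
      _ ≤ _ := by
          apply Finset.sum_le_sum_of_subset_of_nonneg (Finset.filter_subset _ _)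
          intros; positivity
  have fin := mk.trans key
  have e4 : Real.exp (-(ε ^ 2 * #S / 4)) = Real.exp (l ^ 2 * #S) / Real.exp (l * (ε * #S)) := by
    rw [← Real.exp_sub]; congr 1; rw [hl]; ring
  rw [e4, ← mul_div_assoc, le_div_iff₀ (Real.exp_pos _)]
  exact fin

/-- Linear functionals on sources are maximised at flat sources. -/
lemma flat_one {A : Type*} [Fintype A] [DecidableEq A] (K : ℕ) (hK : 1 ≤ K)
    (hKA : K ≤ Fintype.card A) (p : A → ℝ) (hp : IsProb p) (hpK : ∀ a, p a ≤ (K : ℝ)⁻¹)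
    (g : A → ℝ) :
    ∃ S : Finset A, #S = K ∧ ∑ a, p a * g a ≤ (K : ℝ)⁻¹ * ∑ a ∈ S, g a := by
  have hne : (powersetCard K (univ : Finset A)).Nonempty :=
    Finset.powersetCard_nonempty.2 (by simpa using hKA)
  obtain ⟨S, hS, hmax⟩ := Finset.exists_max_image _ (fun S => ∑ a ∈ S, g a) hne
  have hSc : #S = K := (Finset.mem_powersetCard.1 hS).2
  have hSne : S.Nonempty := by rw [← Finset.card_pos]; omega
  obtain ⟨s, hs, hmin⟩ := Finset.exists_min_image S g hSne
  refine ⟨S, hSc, ?_⟩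
  have hout : ∀ x, x ∉ S → g x ≤ g s := by
    intro x hx
    have hx' : x ∉ S.erase s := fun h => hx (Finset.mem_of_mem_erase h)
    have h1 := hmax (insert x (S.erase s)) (by
      rw [Finset.mem_powersetCard]
      refine ⟨Finset.subset_univ _, ?_⟩
      rw [Finset.card_insert_of_notMem hx', Finset.card_erase_of_mem hs]
      omega)
    rw [Finset.sum_insert hx'] at h1
    have := Finset.add_sum_erase S g hs
    linarith
  have hKpos : (0 : ℝ) < K := by exact_mod_cast hK
  have main : ∑ a, p a * (g a - g s) ≤ ∑ a ∈ S, (K : ℝ)⁻¹ * (g a - g s) := by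
    rw [← Finset.univ_inter S, ← Finset.sum_ite_mem]
    apply Finset.sum_le_sum
    intro a _
    split_ifs with h
    · exact mul_le_mul_of_nonneg_right (hpK a) (by linarith [hmin a h])
    · have := hout a h
      have := hp.1 a
      nlinarith
  simp_rw [mul_sub] at main
  rw [Finset.sum_sub_distrib, Finset.sum_sub_distrib, ← Finset.sum_mul, hp.2, ← Finset.mul_sum,
    Finset.sum_const, hSc, nsmul_eq_mul, ← mul_assoc, mul_inv_cancel₀ hKpos.ne'] at main
  linarith

lemma flat_two {A : Type*} [Fintype A] [DecidableEq A] (K : ℕ) (hK : 1 ≤ K)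
    (hKA : K ≤ Fintype.card A) (p q : A → ℝ) (hp : IsProb p) (hpK : ∀ a, p a ≤ (K : ℝ)⁻¹)
    (hq : IsProb q) (hqK : ∀ a, q a ≤ (K : ℝ)⁻¹)
    (g : A → A → ℝ) :
    ∃ S₁ S₂ : Finset A, #S₁ = K ∧ #S₂ = K ∧
      ∑ x, ∑ y, p x * q y * g x y ≤ (K : ℝ)⁻¹ * ((K : ℝ)⁻¹ * ∑ i ∈ S₁ ×ˢ S₂, g i.1 i.2) := by
  obtain ⟨S₁, h₁, e₁⟩ := flat_one K hK hKA p hp hpK (fun x => ∑ y, q y * g x y)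
  obtain ⟨S₂, h₂, e₂⟩ := flat_one K hK hKA q hq hqK (fun y => ∑ x ∈ S₁, g x y)
  refine ⟨S₁, S₂, h₁, h₂, ?_⟩
  have hKpos : (0 : ℝ) ≤ (K : ℝ)⁻¹ := by positivity
  calc ∑ x, ∑ y, p x * q y * g x y = ∑ x, p x * ∑ y, q y * g x y := by
        simp_rw [Finset.mul_sum, mul_assoc]
    _ ≤ _ := e₁
    _ = (K : ℝ)⁻¹ * ∑ y, q y * ∑ x ∈ S₁, g x y := by
        rw [Finset.sum_comm]; simp_rw [Finset.mul_sum]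
    _ ≤ (K : ℝ)⁻¹ * ((K : ℝ)⁻¹ * ∑ y ∈ S₂, ∑ x ∈ S₁, g x y) :=
        mul_le_mul_of_nonneg_left e₂ hKpos
    _ = _ := by rw [Finset.sum_product_right]

lemma card_biUnion_aux {ι F : Type*} [DecidableEq F] (s : Finset ι) (t : ι → Finset F) (c n : ℝ)
    (hc : 0 ≤ c) (hn : (#s : ℝ) ≤ n) (h : ∀ i ∈ s, (#(t i) : ℝ) ≤ c) :
    (#(s.biUnion t) : ℝ) ≤ n * c := by
  calc (#(s.biUnion t) : ℝ) ≤ ∑ i ∈ s, (#(t i) : ℝ) := by exact_mod_cast Finset.card_biUnion_le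
    _ ≤ ∑ i ∈ s, c := Finset.sum_le_sum h
    _ = #s * c := by rw [Finset.sum_const, nsmul_eq_mul]
    _ ≤ n * c := mul_le_mul_of_nonneg_right hn hc

/-- Random functions are good. -/
lemma exists_good {A Z : Type*} [Fintype A] [Fintype Z] [DecidableEq A] [DecidableEq Z]
    [Nonempty Z] (K : ℕ) (hK : 1 ≤ K) (ε : ℝ) (he : 0 ≤ ε) (he1 : ε ≤ 1)
    (hnum : 2 * ((Fintype.card A : ℝ) ^ K) ^ 3 * 2 ^ (K * Fintype.card Z)
      * Real.exp (-(ε ^ 2 * (K * K) / 4)) < 1) :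
    ∃ f : A × A → Z, ∀ b : Bool, ∀ S₁ S₂ S' : Finset A, #S₁ = K → #S₂ = K → #S' = K →
      ∀ T : Finset (A × Z), T ⊆ S' ×ˢ univ →
      ∑ i ∈ S₁ ×ˢ S₂, hTest T (cond b i.1 i.2) (f i) ≤ ε * (K * K) := by
  classical
  set P := powersetCard K (univ : Finset A) with hP
  let bad : Bool → Finset A → Finset A → Finset (A × Z) → Finset (A × A → Z) := fun b S₁ S₂ T =>
    {f | ε * #(S₁ ×ˢ S₂) < ∑ i ∈ S₁ ×ˢ S₂, hTest T (cond b i.1 i.2) (f i)}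
  let U : Finset (A × A → Z) := (univ : Finset Bool).biUnion fun b => P.biUnion fun S₁ =>
    P.biUnion fun S₂ => P.biUnion fun S' => (S' ×ˢ (univ : Finset Z)).powerset.biUnion fun T =>
      bad b S₁ S₂ T
  set F : ℝ := (Fintype.card (A × A → Z) : ℝ) with hF
  have hFpos : 0 < F := by rw [hF]; exact_mod_cast Fintype.card_pos
  set δ := Real.exp (-(ε ^ 2 * (K * K) / 4)) with hδ
  have hPc : (#P : ℝ) ≤ (Fintype.card A : ℝ) ^ K := by
    rw [hP, Finset.card_powersetCard, Finset.card_univ]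
    exact_mod_cast Nat.choose_le_pow _ _
  have hbad : ∀ b, ∀ S₁ ∈ P, ∀ S₂ ∈ P, ∀ T, (#(bad b S₁ S₂ T) : ℝ) ≤ F * δ := by
    intro b S₁ h₁ S₂ h₂ T
    have := chernoff (S₁ ×ˢ S₂) (fun i z => hTest T (cond b i.1 i.2) z)
      (fun i => hTest_sum T _) (fun i z => hTest_abs T _ z) ε he he1
    have hc : ((#(S₁ ×ˢ S₂) : ℕ) : ℝ) = K * K := by
      rw [Finset.card_product, (Finset.mem_powersetCard.1 h₁).2, (Finset.mem_powersetCard.1 h₂).2]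
      push_cast; rfl
    rw [hδ, ← hc]
    exact this
  set N : ℝ := (Fintype.card A : ℝ) ^ K with hN
  set Q : ℝ := 2 ^ (K * Fintype.card Z) with hQ
  have hN0 : 0 ≤ N := by positivity
  have hQ0 : 0 ≤ Q := by positivity
  have hδ0 : 0 ≤ δ := (Real.exp_pos _).le
  have hU : (#U : ℝ) ≤ 2 * (N * (N * (N * (Q * (F * δ))))) := by
    refine card_biUnion_aux _ _ _ _ (by positivity) (by simp) ?_
    intro b _
    refine card_biUnion_aux _ _ _ _ (by positivity) hPc ?_
    intro S₁ h₁
    refine card_biUnion_aux _ _ _ _ (by positivity) hPc ?_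
    intro S₂ h₂
    refine card_biUnion_aux _ _ _ _ (by positivity) hPc ?_
    intro S' h'
    refine card_biUnion_aux _ _ _ _ (by positivity) ?_ ?_
    · rw [Finset.card_powerset, Finset.card_product, (Finset.mem_powersetCard.1 h').2,
        Finset.card_univ, hQ]
      push_cast
      exact le_rfl
    · intro T _
      exact hbad b S₁ h₁ S₂ h₂ T
  have hlt : #U < #(univ : Finset (A × A → Z)) := by
    have : (#U : ℝ) < F := by
      calc (#U : ℝ) ≤ F * (2 * N ^ 3 * Q * δ) := by
            refine hU.trans (le_of_eq ?_); ring
        _ < F * 1 := mul_lt_mul_of_pos_left hnum hFpos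
        _ = F := mul_one F
    rw [Finset.card_univ]
    rw [hF] at this
    exact_mod_cast this
  obtain ⟨f, -, hf⟩ := Finset.exists_mem_notMem_of_card_lt_card hlt
  refine ⟨f, ?_⟩
  intro b S₁ S₂ S' h₁ h₂ h' T hT
  by_contra hcon
  push Not at hcon
  apply hf
  simp only [U, Finset.mem_biUnion]
  refine ⟨b, mem_univ _, S₁, ?_, S₂, ?_, S', ?_, T, Finset.mem_powerset.2 hT, ?_⟩
  · rw [hP, Finset.mem_powersetCard]; exact ⟨Finset.subset_univ _, h₁⟩
  · rw [hP, Finset.mem_powersetCard]; exact ⟨Finset.subset_univ _, h₂⟩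
  · rw [hP, Finset.mem_powersetCard]; exact ⟨Finset.subset_univ _, h'⟩
  · simp only [bad, Finset.mem_filter, Finset.mem_univ, true_and]
    rw [Finset.card_product, h₁, h₂]
    push_cast
    exact hcon

lemma good_sources {A Z : Type*} [Fintype A] [Fintype Z] [DecidableEq A] [DecidableEq Z]
    (K : ℕ) (hK : 1 ≤ K) (hKA : K ≤ Fintype.card A) (ε : ℝ) (f : A × A → Z)
    (hf : ∀ b : Bool, ∀ S₁ S₂ S' : Finset A, #S₁ = K → #S₂ = K → #S' = K →
      ∀ T : Finset (A × Z), T ⊆ S' ×ˢ univ →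
      ∑ i ∈ S₁ ×ˢ S₂, hTest T (cond b i.1 i.2) (f i) ≤ ε * (K * K))
    (b : Bool) (p q : A → ℝ) (hp : IsProb p) (hpK : ∀ a, p a ≤ (K : ℝ)⁻¹)
    (hq : IsProb q) (hqK : ∀ a, q a ≤ (K : ℝ)⁻¹) (T : Finset (A × Z)) :
    ∑ x, ∑ y, p x * q y * hTest T (cond b x y) (f (x, y)) ≤ ε := by
  obtain ⟨S₁, S₂, h₁, h₂, h⟩ := flat_two K hK hKA p q hp hpK hq hqK
    (fun x y => hTest T (cond b x y) (f (x, y)))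
  have hKpos : (0 : ℝ) < K := by exact_mod_cast hK
  refine h.trans ?_
  have h' : #(cond b S₁ S₂) = K := by cases b <;> assumption
  have h3 := hf b S₁ S₂ (cond b S₁ S₂) h₁ h₂ h' (T ∩ (cond b S₁ S₂) ×ˢ univ)
    Finset.inter_subset_right
  have h4 : ∑ i ∈ S₁ ×ˢ S₂, hTest (T ∩ (cond b S₁ S₂) ×ˢ univ) (cond b i.1 i.2) (f i)
      = ∑ i ∈ S₁ ×ˢ S₂, hTest T (cond b i.1 i.2) (f (i.1, i.2)) := by
    apply Finset.sum_congr rfl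
    intro i hi
    rw [Finset.mem_product] at hi
    apply hTest_congr
    cases b
    · exact hi.2
    · exact hi.1
  rw [h4] at h3
  rw [← mul_assoc]
  calc _ ≤ (K : ℝ)⁻¹ * (K : ℝ)⁻¹ * (ε * (K * K)) :=
        mul_le_mul_of_nonneg_left h3 (by positivity)
    _ = ε := by field_simp

lemma statDist_le_of_hTest {Z W V : Type*} [Fintype Z] [Fintype W] [Fintype V] [DecidableEq Z]
    [DecidableEq W] [Nonempty Z] (g : W → V → Z) (w : W → V → ℝ) (r : W → ℝ)
    (hr : ∀ c, ∑ v, w c v = r c) (ε : ℝ)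
    (H : ∀ T : Finset (W × Z), ∑ c, ∑ v, w c v * hTest T c (g c v) ≤ ε) :
    statDist (fun z : Z × W => ∑ v, if g z.2 v = z.1 then w z.2 v else 0)
      (fun z => unif Z z.1 * r z.2) ≤ ε := by
  have key : ∀ T : Finset (Z × W),
      ∑ z ∈ T, (∑ v, if g z.2 v = z.1 then w z.2 v else 0) - ∑ z ∈ T, unif Z z.1 * r z.2
        = ∑ c, ∑ v, w c v * hTest ({a : W × Z | (a.2, a.1) ∈ T} : Finset _) c (g c v) := by
    intro T
    rw [← Finset.sum_sub_distrib, ← Finset.univ_inter T, ← Finset.sum_ite_mem,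
      Fintype.sum_prod_type_right]
    apply Finset.sum_congr rfl
    intro c _
    unfold hTest
    simp_rw [Finset.mul_sum]
    rw [Finset.sum_comm]
    apply Finset.sum_congr rfl
    intro z _
    simp only [Finset.univ_inter, Finset.mem_filter, Finset.mem_univ, true_and]
    split_ifs with hz
    · rw [← hr, Finset.mul_sum, ← Finset.sum_sub_distrib]
      apply Finset.sum_congr rfl
      intro v _
      unfold unif
      split_ifs <;> ring
    · simp
  have hcompl : ∀ (T : Finset (W × Z)) c z, hTest Tᶜ c z = - hTest T c z := by
    intro T c z
    have h0 : hTest Tᶜ c z + hTest T c z = 0 := by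
      unfold hTest
      rw [← Finset.sum_add_distrib]
      have : ∀ x : Z, ((if (c, x) ∈ Tᶜ then ((if z = x then (1 : ℝ) else 0) - (Fintype.card Z : ℝ)⁻¹) else 0)
          + (if (c, x) ∈ T then ((if z = x then (1 : ℝ) else 0) - (Fintype.card Z : ℝ)⁻¹) else 0))
          = (if z = x then (1 : ℝ) else 0) - (Fintype.card Z : ℝ)⁻¹ := by
        intro x
        by_cases hx : (c, x) ∈ T <;> simp [hx]
      simp_rw [this]
      rw [Finset.sum_sub_distrib]
      simp
    linarith
  apply ciSup_le
  intro T
  rw [key, abs_le]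
  refine ⟨?_, H _⟩
  have := H ({a : W × Z | (a.2, a.1) ∈ T} : Finset _)ᶜ
  simp_rw [hcompl, mul_neg, Finset.sum_neg_distrib] at this
  linarith

lemma main_case {A Z : Type*} [Fintype A] [Fintype Z] [DecidableEq A] [DecidableEq Z]
    [Nonempty Z] [Nonempty A] (K : ℕ) (hK : 1 ≤ K) (hKA : K ≤ Fintype.card A) (ε : ℝ)
    (f : A × A → Z)
    (hf : ∀ b : Bool, ∀ S₁ S₂ S' : Finset A, #S₁ = K → #S₂ = K → #S' = K →
      ∀ T : Finset (A × Z), T ⊆ S' ×ˢ univ →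
      ∑ i ∈ S₁ ×ˢ S₂, hTest T (cond b i.1 i.2) (f i) ≤ ε * (K * K))
    (pX : A → ℝ) (pY : A × A → ℝ) (hX : IsProb pX) (hY : IsProb pY)
    (hXK : ∀ a, pX a ≤ (K : ℝ)⁻¹) (hYK : ∀ y₁, ∑ y₂, pY (y₁, y₂) ≤ (K : ℝ)⁻¹) :
    statDist (fun z : Z × (A × A) => ∑ x : A, if f (x, z.2.1) = z.1 then pX x * pY z.2 else 0)
        (fun z => unif Z z.1 * pY z.2) ≤ ε ∧
    statDist (fun z : Z × A => ∑ y : A × A, if f (z.2, y.1) = z.1 then pX z.2 * pY y else 0)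
        (fun z => unif Z z.1 * pX z.2) ≤ ε := by
  have hq : IsProb (fun y₁ => ∑ y₂, pY (y₁, y₂)) := by
    refine ⟨fun a => Finset.sum_nonneg fun b _ => hY.1 _, ?_⟩
    rw [← Fintype.sum_prod_type]; exact hY.2
  have G := good_sources K hK hKA ε f hf
  constructor
  · refine statDist_le_of_hTest (fun (y : A × A) x => f (x, y.1)) (fun y x => pX x * pY y) pY
      ?_ ε ?_
    · intro c; rw [← Finset.sum_mul, hX.2, one_mul]
    · intro T
      let G' : A → A → ℝ := fun y₁ y₂ => ∑ x, pX x * hTest T (y₁, y₂) (f (x, y₁))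
      have hs : ∀ y₁, ∃ s, ∀ y₂, G' y₁ y₂ ≤ G' y₁ s := fun y₁ => Finite.exists_max (G' y₁)
      choose s hs using hs
      let T' : Finset (A × Z) := {a | ((a.1, s a.1), a.2) ∈ T}
      have hT' : ∀ y₁ w, hTest T' y₁ w = hTest T (y₁, s y₁) w := by
        intro y₁ w
        unfold hTest
        simp [T']
      refine le_trans ?_ (G false pX _ hX hXK hq hYK T')
      simp only [cond_false, hT']
      rw [Fintype.sum_prod_type]
      conv_rhs => rw [Finset.sum_comm]
      apply Finset.sum_le_sum
      intro y₁ _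
      have e1 : ∑ x, pX x * (∑ y₂, pY (y₁, y₂)) * hTest T (y₁, s y₁) (f (x, y₁))
          = ∑ y₂, pY (y₁, y₂) * G' y₁ (s y₁) := by
        rw [← Finset.sum_mul, Finset.mul_sum]
        apply Finset.sum_congr rfl
        intros; ring
      rw [e1]
      apply Finset.sum_le_sum
      intro y₂ _
      have e2 : ∑ x, pX x * pY (y₁, y₂) * hTest T (y₁, y₂) (f (x, y₁))
          = pY (y₁, y₂) * G' y₁ y₂ := by
        rw [Finset.mul_sum]
        apply Finset.sum_congr rfl
        intros; ring
      rw [e2]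
      exact mul_le_mul_of_nonneg_left (hs y₁ y₂) (hY.1 _)
  · refine statDist_le_of_hTest (fun x (y : A × A) => f (x, y.1)) (fun x y => pX x * pY y) pX
      ?_ ε ?_
    · intro c; rw [← Finset.mul_sum, hY.2, mul_one]
    · intro T
      refine le_trans (le_of_eq ?_) (G true pX _ hX hXK hq hYK T)
      apply Finset.sum_congr rfl
      intro x _
      rw [Fintype.sum_prod_type]
      apply Finset.sum_congr rfl
      intro y _
      rw [Finset.mul_sum, Finset.sum_mul]
      rfl

lemma numerics (n k : ℕ) (hn : 3 ≤ n) (hkn : k ≤ n)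
    (h : Real.logb 2 n ^ (12 : ℕ) ≤ (k : ℝ)) :
    2 * (((2 ^ n : ℕ) : ℝ) ^ (2 ^ k)) ^ 3 * 2 ^ (2 ^ k * 2 ^ (9 * k / 10))
      * Real.exp (-(((2 : ℝ) ^ (-(k : ℝ) ^ (1 / 2 : ℝ))) ^ 2
        * (((2 ^ k : ℕ) : ℝ) * ((2 ^ k : ℕ) : ℝ)) / 4)) < 1 := by
  set L := Real.logb 2 n with hL
  have hnpos : (0 : ℝ) < n := by exact_mod_cast (by omega : 0 < n)
  have hn2 : (2 : ℝ) ^ L = n := Real.rpow_logb (by norm_num) (by norm_num) hnpos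
  have hkn' : (k : ℝ) ≤ n := by exact_mod_cast hkn
  have hL1 : (3 / 2 : ℝ) ≤ L := by
    rw [hL, Real.le_logb_iff_rpow_le (by norm_num) hnpos]
    have h3 : (3 : ℝ) ≤ n := by exact_mod_cast hn
    refine le_trans ?_ h3
    have : ((2 : ℝ) ^ (3 / 2 : ℝ)) ^ 2 = 8 := by
      rw [← Real.rpow_natCast, ← Real.rpow_mul (by norm_num)]; norm_num
    have hp : 0 ≤ (2 : ℝ) ^ (3 / 2 : ℝ) := by positivity
    nlinarith
  have hk1 : (128 : ℝ) ≤ k := by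
    refine le_trans ?_ h
    calc (128 : ℝ) ≤ (3 / 2) ^ 12 := by norm_num
      _ ≤ L ^ 12 := by gcongr
  have hL2 : (7 : ℝ) ≤ L := by
    rw [hL, Real.le_logb_iff_rpow_le (by norm_num) hnpos]
    refine le_trans ?_ (hk1.trans hkn')
    norm_num
  have hk2 : (10 ^ 10 : ℝ) ≤ k := by
    refine le_trans ?_ h
    calc (10 ^ 10 : ℝ) ≤ 7 ^ 12 := by norm_num
      _ ≤ L ^ 12 := by gcongr
  have hLk : L ≤ k / 10 := by
    have : (7 : ℝ) ^ 11 * L ≤ L ^ 12 := by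
      rw [pow_succ L 11]
      gcongr
    have : (10 : ℝ) * L ≤ 7 ^ 11 * L := by
      gcongr; norm_num
    linarith
  set s : ℝ := (k : ℝ) ^ (1 / 2 : ℝ) with hs
  have hs0 : 0 ≤ s := by positivity
  have hss : s * s = k := by
    rw [hs, ← Real.sqrt_eq_rpow]; exact Real.mul_self_sqrt (by positivity)
  have hs1 : (10 ^ 5 : ℝ) ≤ s := by nlinarith
  have hs2 : 2 * s + 2 ≤ k / 20 := by nlinarith
  -- main inequality
  have main : 1 + 3 * (n : ℝ) + 2 ^ (9 * k / 10) ≤ ((2 : ℝ) ^ (-s)) ^ 2 * 2 ^ k / 4 := by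
    have e : ((2 : ℝ) ^ (-s)) ^ 2 * 2 ^ k / 4 = (2 : ℝ) ^ ((k : ℝ) - (2 * s + 2)) := by
      rw [Real.rpow_sub (by norm_num), Real.rpow_add (by norm_num), ← Real.rpow_natCast 2 k,
        ← Real.rpow_natCast _ 2, ← Real.rpow_mul (by norm_num), div_mul_eq_div_div]
      rw [show -s * ((2 : ℕ) : ℝ) = -(2 * s) by push_cast; ring, Real.rpow_neg (by norm_num)]
      norm_num
      ring
    rw [e]
    have h1 : (n : ℝ) ≤ (2 : ℝ) ^ (9 / 10 * k : ℝ) := by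
      rw [← hn2]
      apply Real.rpow_le_rpow_of_exponent_le (by norm_num)
      linarith
    have h2 : (2 : ℝ) ^ (9 * k / 10) ≤ (2 : ℝ) ^ (9 / 10 * k : ℝ) := by
      rw [← Real.rpow_natCast]
      apply Real.rpow_le_rpow_of_exponent_le (by norm_num)
      have : ((9 * k / 10 : ℕ) : ℝ) ≤ ((9 * k : ℕ) : ℝ) / ((10 : ℕ) : ℝ) := Nat.cast_div_le
      push_cast at this ⊢
      linarith
    have h3 : (1 : ℝ) ≤ (2 : ℝ) ^ (9 / 10 * k : ℝ) :=
      Real.one_le_rpow (by norm_num) (by positivity)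
    have h4 : (2 : ℝ) ^ (9 / 10 * k + 3 : ℝ) ≤ (2 : ℝ) ^ ((k : ℝ) - (2 * s + 2)) := by
      apply Real.rpow_le_rpow_of_exponent_le (by norm_num)
      linarith
    rw [Real.rpow_add (by norm_num)] at h4
    have h5 : (2 : ℝ) ^ (3 : ℝ) = 8 := by norm_num
    rw [h5] at h4
    linarith
  set M : ℕ := 2 ^ (9 * k / 10) with hM
  set K : ℕ := 2 ^ k with hK
  have hK1 : (1 : ℝ) ≤ K := by exact_mod_cast Nat.one_le_two_pow
  set J : ℕ := 1 + 3 * n * K + K * M with hJ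
  have eJ : 2 * (((2 ^ n : ℕ) : ℝ) ^ K) ^ 3 * 2 ^ (K * M) = (2 : ℝ) ^ J := by
    push_cast
    rw [hJ]
    ring
  rw [eJ]
  have hlt : (2 : ℝ) ^ J < Real.exp J := by
    have : (2 : ℝ) < Real.exp 1 := by have := Real.exp_one_gt_d9; linarith
    have h2 := pow_lt_pow_left₀ this (by norm_num) (by omega : J ≠ 0)
    rwa [← Real.exp_nat_mul, mul_one] at h2
  have hJle : (J : ℝ) ≤ ((2 : ℝ) ^ (-s)) ^ 2 * ((K : ℝ) * K) / 4 := by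
    have hKr : (K : ℝ) = 2 ^ k := by rw [hK]; push_cast; rfl
    have hMr : (M : ℝ) = 2 ^ (9 * k / 10) := by rw [hM]; push_cast; rfl
    rw [← hKr, ← hMr] at main
    have := mul_le_mul_of_nonneg_left main (by linarith : (0 : ℝ) ≤ K)
    rw [hJ]
    push_cast
    nlinarith
  calc _ < Real.exp J * Real.exp (-(((2 : ℝ) ^ (-s)) ^ 2 * ((K : ℝ) * K) / 4)) := by
        gcongr
    _ ≤ 1 := by
        rw [← Real.exp_add, Real.exp_le_one_iff]
        linarith

lemma unif_of_le {α : Type*} [Fintype α] (p : α → ℝ) (hp : IsProb p)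
    (c : ℝ) (hc : Fintype.card α * c = 1) (h : ∀ a, p a ≤ c) (a : α) : p a = c := by
  have : ∑ a, p a = ∑ _a : α, c := by
    rw [hp.2, Finset.sum_const, Finset.card_univ, nsmul_eq_mul, hc]
  exact (Finset.sum_eq_sum_iff_of_le (fun a _ => h a)).1 this a (mem_univ _)

lemma statDist_self {α : Type*} [Fintype α] (p : α → ℝ) : statDist p p = 0 := by
  unfold statDist; simp

/-- There is a constant `c > 0` such that for all `n, k` with
`k ≥ (log₂ n)^12` there is a function `IExt : {0,1}ⁿ × {0,1}^{2n} → {0,1}^m`,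
`m = ⌊0.9k⌋`, such that for every `(n,k)`-source `X` and every independent
`(k,k)` block source `Y = (Y₁, Y₂)` with blocks on `{0,1}ⁿ`,
`|(IExt(X,Y), Y) − (U_m, Y)| ≤ ε` and `|(IExt(X,Y), X) − (U_m, X)| ≤ ε`
where `ε = 2^{−k^c}`. -/
theorem three_source_extractor_block_version :
    ∃ c : ℝ, 0 < c ∧
      ∀ n k : ℕ, Real.logb 2 n ^ (12 : ℕ) ≤ (k : ℝ) →
        ∃ IExt : BitStr n → BitStr n × BitStr n → BitStr (9 * k / 10),
          ∀ (pX : BitStr n → ℝ) (pY : BitStr n × BitStr n → ℝ),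
            IsProb pX → IsProb pY → IsKSource pX (k : ℝ) →
            IsBlockSource2 pY (k : ℝ) (k : ℝ) →
            statDist
                (fun z : BitStr (9 * k / 10) × (BitStr n × BitStr n) =>
                  ∑ x : BitStr n, if IExt x z.2 = z.1 then pX x * pY z.2 else 0)
                (fun z => unif (BitStr (9 * k / 10)) z.1 * pY z.2)
              ≤ (2 : ℝ) ^ (-(k : ℝ) ^ c) ∧
            statDist
                (fun z : BitStr (9 * k / 10) × BitStr n =>
                  ∑ y : BitStr n × BitStr n, if IExt z.2 y = z.1 then pX z.2 * pY y else 0)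
                (fun z => unif (BitStr (9 * k / 10)) z.1 * pX z.2)
              ≤ (2 : ℝ) ^ (-(k : ℝ) ^ c) := by

  refine ⟨1 / 2, by norm_num, ?_⟩
  intro n k h
  by_cases hnk : n < k
  · refine ⟨fun _ _ _ => false, ?_⟩
    intro pX pY hX _ hXK _
    exfalso
    have h1 : (1 : ℝ) ≤ ∑ _x : BitStr n, (2 : ℝ) ^ (-(k : ℝ)) := by
      rw [← hX.2]; exact Finset.sum_le_sum fun a _ => hXK a
    rw [Finset.sum_const, Finset.card_univ, nsmul_eq_mul] at h1
    simp only [Fintype.card_fun, Fintype.card_bool, Fintype.card_fin] at h1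
    push_cast at h1
    rw [← Real.rpow_natCast, ← Real.rpow_add (by norm_num)] at h1
    have h2 : (2 : ℝ) ^ ((n : ℝ) + -(k : ℝ)) < 1 := by
      apply Real.rpow_lt_one_of_one_lt_of_neg (by norm_num)
      have : (n : ℝ) < k := by exact_mod_cast hnk
      linarith
    linarith
  push Not at hnk
  by_cases hn : 3 ≤ n
  · have hnum := numerics n k hn hnk h
    obtain ⟨f, hf⟩ := exists_good (A := BitStr n) (Z := BitStr (9 * k / 10)) (2 ^ k)
      Nat.one_le_two_pow ((2 : ℝ) ^ (-(k : ℝ) ^ (1 / 2 : ℝ))) (by positivity)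
      (Real.rpow_le_one_of_one_le_of_nonpos (by norm_num)
        (neg_nonpos.2 (by positivity))) (by simpa using hnum)
    refine ⟨fun x y => f (x, y.1), ?_⟩
    intro pX pY hX hY hXK hYK
    have hKe : (2 : ℝ) ^ (-(k : ℝ)) = ((2 ^ k : ℕ) : ℝ)⁻¹ := by
      rw [Real.rpow_neg (by norm_num), Real.rpow_natCast]; push_cast; rfl
    refine main_case (2 ^ k) Nat.one_le_two_pow ?_ _ f hf pX pY hX hY ?_ ?_
    · simpa using Nat.pow_le_pow_right (by norm_num) hnk
    · intro a; rw [← hKe]; exact hXK a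
    · intro a; rw [← hKe]; exact hYK.1 a
  by_cases hk : k ≤ 1
  · have hm : 9 * k / 10 = 0 := by omega
    rw [hm]
    refine ⟨fun _ _ => default, ?_⟩
    intro pX pY hX hY _ _
    have e1 : (fun z : BitStr 0 × (BitStr n × BitStr n) =>
        ∑ x : BitStr n, if (default : BitStr 0) = z.1 then pX x * pY z.2 else 0)
        = (fun z => unif (BitStr 0) z.1 * pY z.2) := by
      funext z
      simp only [Subsingleton.elim (default : BitStr 0) z.1, if_true]
      rw [← Finset.sum_mul, hX.2]
      simp [unif]
    have e2 : (fun z : BitStr 0 × BitStr n =>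
        ∑ y : BitStr n × BitStr n, if (default : BitStr 0) = z.1 then pX z.2 * pY y else 0)
        = (fun z => unif (BitStr 0) z.1 * pX z.2) := by
      funext z
      simp only [Subsingleton.elim (default : BitStr 0) z.1, if_true]
      rw [← Finset.mul_sum, hY.2]
      simp [unif]
    rw [e1, e2, statDist_self, statDist_self]
    constructor <;> positivity
  · have hn2 : n = 2 := by omega
    have hk2 : k = 2 := by omega
    subst hn2 hk2
    refine ⟨fun x y _ => xor (x 0) (y.1 0), ?_⟩
    intro pX pY hX hY hXK hYK
    have hq : IsProb (fun y₁ => ∑ y₂, pY (y₁, y₂)) := by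
      refine ⟨fun a => Finset.sum_nonneg fun b _ => hY.1 _, ?_⟩
      rw [← Fintype.sum_prod_type]; exact hY.2
    have hc : (2 : ℝ) ^ (-((2 : ℕ) : ℝ)) = 1 / 4 := by
      rw [Real.rpow_neg (by norm_num), Real.rpow_natCast]; norm_num
    have uX := unif_of_le pX hX (1 / 4) (by simp) (fun a => hc ▸ hXK a)
    have uY := unif_of_le _ hq (1 / 4) (by simp) (fun a => hc ▸ hYK.1 a)
    have cnt : ∀ (b : Bool) (z : BitStr (9 * 2 / 10)), ∑ x : BitStr 2,
        (if (fun _ => xor (x 0) b : BitStr (9 * 2 / 10)) = z then (1 : ℕ) else 0) = 2 := by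
      decide
    have cnt' : ∀ (b : Bool) (z : BitStr (9 * 2 / 10)), ∑ x : BitStr 2,
        (if (fun _ => xor b (x 0) : BitStr (9 * 2 / 10)) = z then (1 : ℕ) else 0) = 2 := by
      decide
    have cntR : ∀ (b : Bool) (z : BitStr (9 * 2 / 10)), ∑ x : BitStr 2,
        (if (fun _ => xor (x 0) b : BitStr (9 * 2 / 10)) = z then (1 : ℝ) else 0) = 2 := by
      intro b z; exact_mod_cast cnt b z
    have cntR' : ∀ (b : Bool) (z : BitStr (9 * 2 / 10)), ∑ x : BitStr 2,
        (if (fun _ => xor b (x 0) : BitStr (9 * 2 / 10)) = z then (1 : ℝ) else 0) = 2 := by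
      intro b z; exact_mod_cast cnt' b z
    have hu : ∀ z, unif (BitStr (9 * 2 / 10)) z = 1 / 2 := by
      intro z; simp [unif]
    have e1 : (fun z : BitStr (9 * 2 / 10) × (BitStr 2 × BitStr 2) =>
        ∑ x : BitStr 2, if (fun _ => xor (x 0) (z.2.1 0)) = z.1 then pX x * pY z.2 else 0)
        = (fun z => unif (BitStr (9 * 2 / 10)) z.1 * pY z.2) := by
      funext z
      rw [hu]
      calc _ = ∑ x : BitStr 2, (if (fun _ => xor (x 0) (z.2.1 0) : BitStr (9 * 2 / 10)) = z.1
              then (1 : ℝ) else 0) * (1 / 4 * pY z.2) := by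
            apply Finset.sum_congr rfl
            intro x _
            rw [uX]
            split_ifs <;> ring
        _ = _ := by
            rw [← Finset.sum_mul, cntR]; ring
    have e2 : (fun z : BitStr (9 * 2 / 10) × BitStr 2 =>
        ∑ y : BitStr 2 × BitStr 2, if (fun _ => xor (z.2 0) (y.1 0)) = z.1
          then pX z.2 * pY y else 0)
        = (fun z => unif (BitStr (9 * 2 / 10)) z.1 * pX z.2) := by
      funext z
      rw [hu, Fintype.sum_prod_type]
      calc _ = ∑ y : BitStr 2, (if (fun _ => xor (z.2 0) (y 0) : BitStr (9 * 2 / 10)) = z.1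
              then (1 : ℝ) else 0) * (1 / 4 * pX z.2) := by
            apply Finset.sum_congr rfl
            intro y _
            have := uY y
            rw [← this]
            split_ifs
            · rw [← Finset.mul_sum]; ring
            · simp
        _ = _ := by
            rw [← Finset.sum_mul, cntR']; ring
    rw [e1, e2, statDist_self, statDist_self]
    constructor <;> positivity
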